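/- Let d ≥ 1 and let ᾱ = (α_1,...,α_d) ∈ ℝ^d be an arbitrary d-tuple of real numbers. Then for every positive integer k, the discrepancy of the k-th convolution power of Q satisfies D(Q^{*k}) ≥ 0.0947 · (1/5)^d · k^{−d/2}. -/

import Mathlib

open MeasureTheory Real
open scoped ENNReal

noncomputable section

/-- The generating measure `Q` on the circle `ℝ/ℤ` of the random walk generated by the
`d`-tuple `α`: mass `1/(2d)` at each point `α j mod 1` and `-α j mod 1`. -/
def circleQ {d : ℕ} (α : Fin d → ℝ) : Measure (AddCircle (1 : ℝ)) :=
  ((2 * d : ℝ≥0∞))⁻¹ •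
    ∑ j : Fin d, (Measure.dirac ((α j : ℝ) : AddCircle (1 : ℝ)) +
      Measure.dirac (((-(α j) : ℝ)) : AddCircle (1 : ℝ)))

/-- `k`-fold convolution power of a measure on the circle. -/
def convPow (μ : Measure (AddCircle (1 : ℝ))) : ℕ → Measure (AddCircle (1 : ℝ))
  | 0 => Measure.dirac 0
  | k + 1 => (convPow μ k).conv μ

/-- The discrepancy of a measure `P` on the circle: the supremum over all arcs
(connected subsets) `I` of `|P(I) - λ(I)|`, where `λ` is Haar (Lebesgue) probability
measure (`volume` on `AddCircle 1`). -/
def discrepancy (P : Measure (AddCircle (1 : ℝ))) : ℝ :=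
  sSup { r : ℝ | ∃ I : Set (AddCircle (1 : ℝ)), IsConnected I ∧
    r = |(P I).toReal - (volume I).toReal| }

/-- The `m`-th Fourier coefficient of a measure on the circle: `∫ e^{-2πimx} dP(x)`. -/
def fourierCoeffMeasure (P : Measure (AddCircle (1 : ℝ))) (m : ℤ) : ℂ :=
  ∫ x, fourier (-m) x ∂P

/-- Euclidean distance from `x ∈ ℝ^d` to the nearest integer lattice point. -/
def latticeDist {d : ℕ} (x : Fin d → ℝ) : ℝ :=
  ⨅ v : Fin d → ℤ, Real.sqrt (∑ i, (x i - v i) ^ 2)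

theorem abs_measure_sub_le_discrepancy (P : Measure (AddCircle (1 : ℝ))) [IsProbabilityMeasure P]
    {I : Set (AddCircle (1 : ℝ))} (hI : IsConnected I) :
    |(P I).toReal - (volume I).toReal| ≤ discrepancy P := by
  refine le_csSup ⟨1, ?_⟩ ⟨I, hI, rfl⟩
  rintro r ⟨J, -, rfl⟩
  have h1 : P.real J ≤ 1 := measureReal_le_one
  have h2 : (volume : Measure (AddCircle (1 : ℝ))).real J ≤ 1 := by
    refine (measureReal_mono (Set.subset_univ J)).trans ?_
    simp [Measure.real]
  have h3 : 0 ≤ P.real J := measureReal_nonneg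
  have h4 : 0 ≤ (volume : Measure (AddCircle (1 : ℝ))).real J := measureReal_nonneg
  change |P.real J - (volume : Measure (AddCircle (1 : ℝ))).real J| ≤ 1
  rw [abs_le]
  constructor <;> linarith

theorem isConnected_closedBall_addCircle (x : AddCircle (1 : ℝ)) {r : ℝ} (hr : 0 ≤ r) :
    IsConnected (Metric.closedBall x r) := by
  induction x using QuotientAddGroup.induction_on with
  | H x =>
  have h : Metric.closedBall (x : AddCircle (1 : ℝ)) r =
      (fun t : ℝ => (t : AddCircle (1 : ℝ))) '' Set.Icc (x - r) (x + r) := by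
    ext y
    induction y using QuotientAddGroup.induction_on with
    | H y =>
    constructor
    · intro hy
      rw [Metric.mem_closedBall, dist_eq_norm, ← AddCircle.coe_sub, AddCircle.norm_eq] at hy
      rw [abs_le] at hy
      simp only [inv_one, one_mul, mul_one] at hy
      refine ⟨y - round (y - x), ⟨by linarith, by linarith⟩, ?_⟩
      have : ((round (y - x) : ℤ) : ℝ) = round (y - x) • (1 : ℝ) := by simp
      simp only [AddCircle.coe_sub]
      rw [this, AddCircle.coe_zsmul, AddCircle.coe_period]
      simp
    · rintro ⟨t, ht, hty⟩
      rw [← hty, Metric.mem_closedBall, dist_eq_norm, ← AddCircle.coe_sub]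
      refine (QuotientAddGroup.norm_mk_le_norm (m := t - x)).trans ?_
      rw [Real.norm_eq_abs, abs_le]
      constructor <;> linarith [ht.1, ht.2]
  rw [h]
  exact (isConnected_Icc (by linarith)).image _ (AddCircle.continuous_mk' 1).continuousOn

theorem re_fourier_coe (m : ℤ) (x : ℝ) :
    (fourier m (x : AddCircle (1 : ℝ))).re = cos (2 * π * m * x) := by
  rw [fourier_coe_apply]
  have : (2 * π * Complex.I * m * x / (1 : ℝ) : ℂ) = ((2 * π * m * x : ℝ) : ℂ) * Complex.I := by
    push_cast; ring
  rw [this, Complex.exp_ofReal_mul_I_re]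

theorem fourier_add_same (m : ℤ) (x y : AddCircle (1 : ℝ)) :
    fourier m (x + y) = fourier m x * fourier m y := by
  simp [fourier_apply, AddCircle.toCircle_add]

theorem norm_fourier_apply (m : ℤ) (x : AddCircle (1 : ℝ)) : ‖fourier m x‖ = 1 := by
  rw [fourier_apply]
  exact Circle.norm_coe _

theorem integrable_fourier (m : ℤ) (μ : Measure (AddCircle (1 : ℝ))) [IsFiniteMeasure μ] :
    Integrable (fun x => fourier m x) μ :=
  .of_bound (by fun_prop) 1 (.of_forall fun x => (norm_fourier_apply m x).le)

theorem integral_abs_cos_two_pi : ∫ x in (-(1 / 4) : ℝ)..(3 / 4), |cos (2 * π * x)| = 2 / π := by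
  have hc : Continuous fun x : ℝ => |cos (2 * π * x)| := by fun_prop
  have hpi := pi_pos
  rw [← intervalIntegral.integral_add_adjacent_intervals (b := 1 / 4)
    (hc.intervalIntegrable _ _) (hc.intervalIntegrable _ _)]
  have h1 : ∫ x in (-(1 / 4) : ℝ)..(1 / 4), |cos (2 * π * x)| =
      ∫ x in (-(1 / 4) : ℝ)..(1 / 4), cos (2 * π * x) := by
    refine intervalIntegral.integral_congr fun x hx => ?_
    rw [Set.uIcc_of_le (by norm_num)] at hx
    refine abs_of_nonneg (cos_nonneg_of_mem_Icc ⟨?_, ?_⟩) <;> nlinarith [hx.1, hx.2]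
  have h2 : ∫ x in (1 / 4 : ℝ)..(3 / 4), |cos (2 * π * x)| =
      ∫ x in (1 / 4 : ℝ)..(3 / 4), -cos (2 * π * x) := by
    refine intervalIntegral.integral_congr fun x hx => ?_
    rw [Set.uIcc_of_le (by norm_num)] at hx
    refine abs_of_nonpos (cos_nonpos_of_pi_div_two_le_of_le ?_ ?_) <;> nlinarith [hx.1, hx.2]
  rw [h1, h2, intervalIntegral.integral_neg,
    intervalIntegral.integral_comp_mul_left _ (by positivity),
    intervalIntegral.integral_comp_mul_left _ (by positivity), integral_cos, integral_cos]
  have e1 : 2 * π * (1 / 4) = π / 2 := by ring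
  have e2 : 2 * π * -(1 / 4) = -(π / 2) := by ring
  have e3 : 2 * π * (3 / 4) = π / 2 + π := by ring
  rw [e1, e2, e3, sin_neg, sin_add_pi, sin_pi_div_two]
  simp only [smul_eq_mul]
  field_simp
  norm_num

theorem integral_abs_re_fourier {m : ℕ} (hm : 0 < m) :
    ∫ x : AddCircle (1 : ℝ), |(fourier m x).re| = 2 / π := by
  have hmp := Measure.measurePreserving_zsmul (volume : Measure (AddCircle (1 : ℝ)))
    (n := (m : ℤ)) (by exact_mod_cast hm.ne')
  have hc : Continuous fun x : AddCircle (1 : ℝ) => |(fourier 1 x).re| := by fun_prop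
  calc ∫ x : AddCircle (1 : ℝ), |(fourier m x).re|
      = ∫ x : AddCircle (1 : ℝ), |(fourier 1 ((m : ℤ) • x)).re| := by
        simp only [fourier_apply, one_smul]
    _ = ∫ x : AddCircle (1 : ℝ), |(fourier 1 x).re| := by
        conv_rhs => rw [← hmp.map_eq]
        rw [integral_map hmp.measurable.aemeasurable hc.aestronglyMeasurable]
    _ = 2 / π := by
        rw [← AddCircle.intervalIntegral_preimage 1 (-(1 / 4)), ← integral_abs_cos_two_pi]
        simp only [re_fourier_coe]
        norm_num

theorem setIntegral_fourier_closedBall {m : ℕ} (hm : 0 < m) :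
    ∫ x in Metric.closedBall (0 : AddCircle (1 : ℝ)) (1 / (4 * m)), fourier m x =
      ((1 / (π * m) : ℝ) : ℂ) := by
  have hm' : (1 : ℝ) ≤ m := by exact_mod_cast hm
  have hm0 : (m : ℂ) ≠ 0 := by exact_mod_cast hm.ne'
  have hpi : (π : ℂ) ≠ 0 := by exact_mod_cast pi_ne_zero
  set r : ℝ := 1 / (4 * m) with hr
  have hr0 : 0 < r := by positivity
  have hr1 : r ≤ 1 / 4 := by
    rw [hr]; exact one_div_le_one_div_of_le (by norm_num) (by linarith)
  have hpre : (fun t : ℝ => (t : AddCircle (1 : ℝ))) ⁻¹' Metric.closedBall 0 r ∩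
      Set.Ioc (-(1 / 2)) (-(1 / 2) + 1) = Set.Icc (-r) r := by
    ext t
    simp only [Set.mem_inter_iff, Set.mem_preimage, mem_closedBall_zero_iff, Set.mem_Ioc,
      Set.mem_Icc, ← abs_le]
    constructor
    · rintro ⟨h, h1, h2⟩
      rwa [(AddCircle.norm_coe_eq_abs_iff 1 one_ne_zero).2] at h
      rw [abs_one, abs_le]
      constructor <;> linarith
    · intro h
      have h' := abs_le.1 h
      refine ⟨?_, by linarith, by linarith⟩
      rwa [(AddCircle.norm_coe_eq_abs_iff 1 one_ne_zero).2]
      rw [abs_one]; linarith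
  rw [← integral_indicator Metric.isClosed_closedBall.measurableSet,
    ← AddCircle.integral_preimage 1 (-(1 / 2))]
  have hms : MeasurableSet ((fun t : ℝ => (t : AddCircle (1 : ℝ))) ⁻¹' Metric.closedBall 0 r) :=
    (Metric.isClosed_closedBall.preimage (AddCircle.continuous_mk' 1)).measurableSet
  calc ∫ a in Set.Ioc (-(1 / 2) : ℝ) (-(1 / 2) + 1), (Metric.closedBall 0 r).indicator
          (fun x : AddCircle (1 : ℝ) => fourier m x) a
      = ∫ a in Set.Ioc (-(1 / 2) : ℝ) (-(1 / 2) + 1),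
          ((fun t : ℝ => (t : AddCircle (1 : ℝ))) ⁻¹' Metric.closedBall 0 r).indicator
          (fun t : ℝ => fourier m (t : AddCircle (1 : ℝ))) a := rfl
    _ = ∫ a in Set.Icc (-r) r, fourier m (a : AddCircle (1 : ℝ)) := by
        rw [integral_indicator hms, Measure.restrict_restrict hms, hpre]
    _ = ∫ a in (-r)..r, Complex.exp (2 * π * Complex.I * m * a) := by
        rw [integral_Icc_eq_integral_Ioc, intervalIntegral.integral_of_le (by linarith)]
        simp only [fourier_coe_apply, Int.cast_natCast, Complex.ofReal_one, div_one]
    _ = ((1 / (π * m) : ℝ) : ℂ) := by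
        rw [integral_exp_mul_complex (by simp [hm0, hpi])]
        have e1 : 2 * π * Complex.I * m * (r : ℂ) = ((π / 2 : ℝ) : ℂ) * Complex.I := by
          rw [hr]; push_cast; field_simp; norm_num
        have e2 : 2 * π * Complex.I * m * ((-r : ℝ) : ℂ) = ((-(π / 2) : ℝ) : ℂ) * Complex.I := by
          rw [hr]; push_cast; field_simp; norm_num
        rw [e1, e2, Complex.exp_mul_I, Complex.exp_mul_I, ← Complex.ofReal_cos,
          ← Complex.ofReal_sin, ← Complex.ofReal_cos, ← Complex.ofReal_sin, cos_neg, sin_neg,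
          cos_pi_div_two, sin_pi_div_two]
        push_cast
        field_simp
        ring

theorem setIntegral_fourier_closedBall_eq_mul (m : ℤ) (r : ℝ) (x : AddCircle (1 : ℝ)) :
    ∫ y in Metric.closedBall x r, fourier m y =
      (∫ y in Metric.closedBall (0 : AddCircle (1 : ℝ)) r, fourier m y) * fourier m x := by
  rw [← integral_indicator Metric.isClosed_closedBall.measurableSet,
    ← integral_indicator Metric.isClosed_closedBall.measurableSet,
    ← integral_add_right_eq_self _ x, ← integral_mul_const]
  congr 1 with y
  by_cases h : y ∈ Metric.closedBall (0 : AddCircle (1 : ℝ)) r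
  · have h' : y + x ∈ Metric.closedBall x r := by simpa [dist_eq_norm] using h
    rw [Set.indicator_of_mem h, Set.indicator_of_mem h', fourier_add_same]
  · have h' : y + x ∉ Metric.closedBall x r := by simpa [dist_eq_norm] using h
    rw [Set.indicator_of_notMem h, Set.indicator_of_notMem h', zero_mul]

theorem integral_measureReal_closedBall_mul_fourier (P : Measure (AddCircle (1 : ℝ)))
    [IsFiniteMeasure P] (m : ℤ) (r : ℝ) :
    ∫ y : AddCircle (1 : ℝ), (P.real (Metric.closedBall y r) : ℂ) * fourier m y =
      (∫ y in Metric.closedBall (0 : AddCircle (1 : ℝ)) r, fourier m y) * ∫ x, fourier m x ∂P := by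
  let S : Set (AddCircle (1 : ℝ) × AddCircle (1 : ℝ)) := {p | dist p.2 p.1 ≤ r}
  have hS : MeasurableSet S :=
    (isClosed_le (by fun_prop) continuous_const).measurableSet
  have hint : Integrable (S.indicator fun p => (fourier m p.1 : ℂ))
      ((volume : Measure (AddCircle (1 : ℝ))).prod P) := by
    refine Integrable.indicator ?_ hS
    refine Integrable.of_bound (C := 1) (by fun_prop) (.of_forall fun p => (norm_fourier_apply m p.1).le)
  have hswap := integral_integral_swap
    (f := fun y x => S.indicator (fun p => (fourier m p.1 : ℂ)) (y, x)) hint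
  calc ∫ y : AddCircle (1 : ℝ), (P.real (Metric.closedBall y r) : ℂ) * fourier m y
      = ∫ y, ∫ x, S.indicator (fun p => (fourier m p.1 : ℂ)) (y, x) ∂P := by
        congr 1 with y
        have : (fun x => S.indicator (fun p => (fourier m p.1 : ℂ)) (y, x)) =
            (Metric.closedBall y r).indicator fun _ => fourier m y := rfl
        rw [this, integral_indicator_const _ Metric.isClosed_closedBall.measurableSet]
        simp
    _ = ∫ x, ∫ y, S.indicator (fun p => (fourier m p.1 : ℂ)) (y, x) ∂volume ∂P := hswap
    _ = ∫ x, (∫ y in Metric.closedBall (0 : AddCircle (1 : ℝ)) r, fourier m y) *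
          fourier m x ∂P := by
        congr 1 with x
        rw [← setIntegral_fourier_closedBall_eq_mul,
          ← integral_indicator Metric.isClosed_closedBall.measurableSet]
        congr 1 with y
        have : (y, x) ∈ S ↔ y ∈ Metric.closedBall x r := by
          simp [S, dist_comm]
        by_cases h : y ∈ Metric.closedBall x r
        · rw [Set.indicator_of_mem h, Set.indicator_of_mem (this.2 h)]
        · rw [Set.indicator_of_notMem h, Set.indicator_of_notMem (this.not.2 h)]
    _ = _ := integral_const_mul _ _

theorem measurable_measureReal_closedBall (P : Measure (AddCircle (1 : ℝ)))
    [IsFiniteMeasure P] (r : ℝ) :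
    Measurable fun y => P.real (Metric.closedBall y r) := by
  let S : Set (AddCircle (1 : ℝ) × AddCircle (1 : ℝ)) := {p | dist p.2 p.1 ≤ r}
  have hS : MeasurableSet S :=
    (isClosed_le (by fun_prop) continuous_const).measurableSet
  exact (measurable_measure_prodMk_left hS).ennreal_toReal

theorem re_integral_fourier_le_discrepancy (P : Measure (AddCircle (1 : ℝ)))
    [IsProbabilityMeasure P] {m : ℕ} (hm : 0 < m) :
    (∫ x, fourier m x ∂P).re ≤ 2 * m * discrepancy P := by
  have hm0 : (0 : ℝ) < m := by exact_mod_cast hm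
  set r : ℝ := 1 / (4 * m) with hr
  set V : ℝ := (volume : Measure (AddCircle (1 : ℝ))).real (Metric.closedBall 0 r) with hV
  have hball : ∀ y : AddCircle (1 : ℝ),
      (volume : Measure (AddCircle (1 : ℝ))).real (Metric.closedBall y r) = V := fun y => by
    rw [hV, Measure.real, Measure.real, AddCircle.volume_closedBall, AddCircle.volume_closedBall]
  have hre : Integrable (fun y : AddCircle (1 : ℝ) => (fourier m y).re) :=
    (integrable_fourier m _).re
  have hPre : Integrable (fun y : AddCircle (1 : ℝ) =>
      P.real (Metric.closedBall y r) * (fourier m y).re) :=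
    hre.bdd_mul (c := 1) (measurable_measureReal_closedBall P r).aestronglyMeasurable
      (.of_forall fun y => by
        rw [Real.norm_eq_abs, abs_of_nonneg measureReal_nonneg]
        exact measureReal_le_one)
  have hPc : Integrable (fun y : AddCircle (1 : ℝ) =>
      (P.real (Metric.closedBall y r) : ℂ) * fourier m y) :=
    Integrable.bdd_mul (c := 1)
      (integrable_fourier m _)
      (Complex.measurable_ofReal.comp
        (measurable_measureReal_closedBall P r)).aestronglyMeasurable
      (.of_forall fun y => by
        rw [Complex.norm_real, Real.norm_eq_abs, abs_of_nonneg measureReal_nonneg]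
        exact measureReal_le_one)
  have hmain : ∫ y : AddCircle (1 : ℝ), P.real (Metric.closedBall y r) * (fourier m y).re =
      1 / (π * m) * (∫ x, fourier m x ∂P).re := by
    have h := congrArg Complex.re (integral_measureReal_closedBall_mul_fourier P m r)
    rw [setIntegral_fourier_closedBall hm, Complex.re_ofReal_mul] at h
    rw [← h]
    refine Eq.trans ?_ (integral_re hPc)
    simp
  have hzero : ∫ y : AddCircle (1 : ℝ), (fourier m y).re = 0 := by
    have h := integral_add_right_eq_self (μ := volume)
      (fun y : AddCircle (1 : ℝ) => (fourier m y).re) ((1 / 2 / (m : ℤ) : ℝ) : AddCircle (1 : ℝ))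
    simp only [fourier_add_half_inv_index (show (m : ℤ) ≠ 0 by exact_mod_cast hm.ne') one_pos,
      Complex.neg_re, integral_neg] at h
    linarith
  have hle : ∫ y : AddCircle (1 : ℝ), (P.real (Metric.closedBall y r) - V) * (fourier m y).re ≤
      ∫ y : AddCircle (1 : ℝ), discrepancy P * |(fourier m y).re| := by
    refine integral_mono ?_ (hre.abs.const_mul _) fun y => ?_
    · simp only [sub_mul]
      exact hPre.sub (hre.const_mul _)
    · refine (le_abs_self _).trans ?_
      simp only [abs_mul]
      gcongr
      rw [← hball y]
      exact abs_measure_sub_le_discrepancy P (isConnected_closedBall_addCircle y (by positivity))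
  simp only [sub_mul] at hle
  rw [integral_sub hPre (hre.const_mul _), hmain, integral_const_mul, integral_const_mul, hzero,
    integral_abs_re_fourier hm] at hle
  have hpi := pi_pos
  have := mul_le_mul_of_nonneg_left hle (show 0 ≤ π * m by positivity)
  field_simp at this
  linarith

instance isProbabilityMeasure_convPow (μ : Measure (AddCircle (1 : ℝ))) [IsProbabilityMeasure μ]
    (k : ℕ) : IsProbabilityMeasure (convPow μ k) := by
  induction k with
  | zero => exact Measure.dirac.isProbabilityMeasure
  | succ k ih => exact Measure.probabilitymeasure_of_probabilitymeasures_conv _ _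

theorem integral_fourier_convPow (μ : Measure (AddCircle (1 : ℝ))) [IsProbabilityMeasure μ]
    (m : ℤ) (k : ℕ) : ∫ x, fourier m x ∂(convPow μ k) = (∫ x, fourier m x ∂μ) ^ k := by
  induction k with
  | zero => simp [convPow]
  | succ k ih =>
    rw [convPow, Measure.conv, integral_map (by fun_prop) (by fun_prop), pow_succ, ← ih,
      ← integral_prod_mul]
    simp only [fourier_add_same]

theorem isProbabilityMeasure_circleQ {d : ℕ} (hd : 1 ≤ d) (α : Fin d → ℝ) :
    IsProbabilityMeasure (circleQ α) := by
  constructor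
  have hd0 : (d : ℝ≥0∞) ≠ 0 := by exact_mod_cast (by omega : d ≠ 0)
  simp only [circleQ, Measure.smul_apply, Measure.finsetSum_apply, Measure.add_apply,
    measure_univ, Finset.sum_const, Finset.card_univ, Fintype.card_fin, smul_eq_mul, nsmul_eq_mul]
  rw [one_add_one_eq_two, mul_comm (d : ℝ≥0∞)]
  exact ENNReal.inv_mul_cancel (by simp [hd0]) (by finiteness)

theorem integral_fourier_circleQ {d : ℕ} (α : Fin d → ℝ) (m : ℤ) :
    ∫ x, fourier m x ∂(circleQ α) = ((1 / d * ∑ j, cos (2 * π * m * α j) : ℝ) : ℂ) := by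
  have h (j : Fin d) : ∫ x : AddCircle (1 : ℝ), fourier m x
      ∂(Measure.dirac (α j : AddCircle (1 : ℝ)) + Measure.dirac ((-(α j) : ℝ) : AddCircle (1 : ℝ))) =
      ((2 * cos (2 * π * m * α j) : ℝ) : ℂ) := by
    rw [integral_add_measure (integrable_fourier m _) (integrable_fourier m _), integral_dirac,
      integral_dirac, fourier_coe_apply, fourier_coe_apply]
    push_cast
    rw [Complex.two_cos]
    congr 2 <;> ring_nf
  rw [circleQ, integral_smul_measure,
    integral_finsetSum_measure fun j _ => integrable_fourier m _,
    Finset.sum_congr rfl fun j _ => h j,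
    ← Complex.ofReal_sum, ← Finset.mul_sum, Complex.real_smul, ← Complex.ofReal_mul]
  congr 1
  simp
  ring

theorem one_sub_le_cos_of_norm_nsmul_le (a δ : ℝ) (m : ℕ)
    (h : ‖m • (a : AddCircle (1 : ℝ))‖ ≤ δ) :
    1 - 2 * π ^ 2 * δ ^ 2 ≤ cos (2 * π * m * a) := by
  rw [← AddCircle.coe_nsmul, AddCircle.norm_eq] at h
  simp only [inv_one, one_mul, mul_one, nsmul_eq_mul] at h
  have h2 : cos (2 * π * m * a) = cos (2 * π * (m * a - round (m * a))) := by
    rw [← cos_sub_int_mul_two_pi _ (round (m * a))]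
    ring_nf
  rw [h2]
  refine le_trans ?_ (one_sub_sq_div_two_le_cos)
  have h3 := sq_le_sq' (abs_le.1 h).1 (abs_le.1 h).2
  nlinarith [sq_nonneg π]

theorem exists_nsmul_coe_norm_le {d : ℕ} (α : Fin d → ℝ) {δ : ℝ} (hδ : 0 < δ) (hδ1 : δ ≤ 1) :
    ∃ m : ℕ, 0 < m ∧ (m : ℝ) ≤ (δ⁻¹) ^ d ∧ ∀ j, ‖m • (α j : AddCircle (1 : ℝ))‖ ≤ δ := by
  let ξ : Fin d → AddCircle (1 : ℝ) := fun j => (α j : AddCircle (1 : ℝ))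
  have hT : 1 ≤ (δ⁻¹) ^ d := one_le_pow₀ ((one_le_inv₀ hδ).2 hδ1)
  set n := ⌊(δ⁻¹) ^ d⌋₊ with hn
  have hn0 : 0 < n := Nat.floor_pos.2 hT
  have hvol : (volume : Measure (Fin d → AddCircle (1 : ℝ))) Set.univ ≤
      (n + 1) • volume (Metric.closedBall (0 : Fin d → AddCircle (1 : ℝ)) (δ / 2)) := by
    rw [closedBall_pi _ (by positivity), ← Set.pi_univ Set.univ, volume_pi_pi, volume_pi_pi]
    simp only [Pi.zero_apply, AddCircle.volume_closedBall, AddCircle.measure_univ,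
      Finset.prod_const, Finset.card_univ, Fintype.card_fin, ENNReal.ofReal_one, one_pow]
    rw [mul_div_cancel₀ _ two_ne_zero, min_eq_right hδ1, ← ENNReal.ofReal_pow hδ.le,
      ← ENNReal.ofReal_nsmul, ENNReal.one_le_ofReal, nsmul_eq_mul]
    have h1 : (δ⁻¹) ^ d ≤ ((n + 1 : ℕ) : ℝ) := by push_cast; exact (Nat.lt_floor_add_one _).le
    calc (1 : ℝ) = (δ⁻¹) ^ d * δ ^ d := by rw [← mul_pow, inv_mul_cancel₀ hδ.ne', one_pow]
      _ ≤ _ := by gcongr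
  obtain ⟨m, hm, hmξ⟩ := NormedAddCommGroup.exists_norm_nsmul_le (μ := volume) ξ hn0 δ hvol
  refine ⟨m, hm.1, ?_, fun j => ?_⟩
  · exact (Nat.cast_le.2 hm.2).trans (Nat.floor_le (by positivity))
  · exact (norm_le_pi_norm (m • ξ) j).trans hmξ

/-- Lower bound on the discrepancy of the walk for an arbitrary `d`-tuple `α`. -/
theorem discrepancy_lower_bound_arbitrary
    {d : ℕ} (hd : 1 ≤ d) (α : Fin d → ℝ) (k : ℕ) (hk : 0 < k) :
    0.0947 * (1 / 5 : ℝ) ^ d * (k : ℝ) ^ (-(d : ℝ) / 2) ≤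
      discrepancy (convPow (circleQ α) k) := by
  have := isProbabilityMeasure_circleQ hd α
  have hk1 : (1 : ℝ) ≤ k := by exact_mod_cast hk
  have hs : 1 ≤ √(k : ℝ) := one_le_sqrt.2 hk1
  set δ : ℝ := 1 / (5 * √k) with hδ
  have hδ0 : 0 < δ := by positivity
  have hδ1 : δ ≤ 1 := by
    rw [hδ, div_le_one (by positivity)]
    linarith
  have hδsq : δ ^ 2 = 1 / (25 * k) := by
    rw [hδ, div_pow, mul_pow, sq_sqrt (by positivity)]
    norm_num
  obtain ⟨m, hm0, hmle, hmα⟩ := exists_nsmul_coe_norm_le α hδ0 hδ1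
  have hpi2 : π ^ 2 ≤ 9.87 := by nlinarith [pi_lt_d4, pi_pos]
  set q : ℝ := 1 / d * ∑ j, cos (2 * π * m * α j) with hq
  have hqle : 1 - 0.7896 / k ≤ q := by
    have h1 : ∀ j, 1 - 0.7896 / k ≤ cos (2 * π * m * α j) := fun j => by
      refine le_trans ?_ (one_sub_le_cos_of_norm_nsmul_le (α j) δ m (hmα j))
      rw [hδsq]
      have : 2 * π ^ 2 * (1 / (25 * k)) = (2 * π ^ 2 / 25) / k := by field_simp
      rw [this]
      gcongr
      linarith
    have h2 := Finset.sum_le_sum fun j (_ : j ∈ Finset.univ) => h1 j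
    rw [Finset.sum_const, Finset.card_univ, Fintype.card_fin, nsmul_eq_mul] at h2
    rw [hq, one_div, inv_mul_eq_div, le_div_iff₀ (by positivity)]
    linarith
  have hk2 : 0.7896 / (k : ℝ) ≤ 0.7896 := div_le_self (by norm_num) hk1
  have hqk : 0.2104 ≤ q ^ k := by
    calc (0.2104 : ℝ) = 1 + k * (-(0.7896 / k)) := by field_simp; norm_num
      _ ≤ (1 + -(0.7896 / k)) ^ k := one_add_mul_le_pow (by linarith) k
      _ ≤ q ^ k := pow_le_pow_left₀ (by linarith) (by linarith) k
  have hD := re_integral_fourier_le_discrepancy (convPow (circleQ α) k) hm0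
  rw [integral_fourier_convPow, integral_fourier_circleQ, ← Complex.ofReal_pow,
    Complex.ofReal_re, Int.cast_natCast, ← hq] at hD
  have hm1 : (0 : ℝ) < m := by exact_mod_cast hm0
  have hscale : (1 / 5 : ℝ) ^ d * (k : ℝ) ^ (-(d : ℝ) / 2) = δ ^ d := by
    have h : (k : ℝ) ^ (-(d : ℝ) / 2) = ((√k)⁻¹) ^ d := by
      rw [inv_pow, sqrt_eq_rpow, ← rpow_natCast, ← rpow_mul (by positivity),
        ← rpow_neg (by positivity)]
      congr 1
      ring
    rw [hδ, h, ← mul_pow, one_div, one_div, mul_inv]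
  have hmδ : (m : ℝ) * δ ^ d ≤ 1 := by
    calc (m : ℝ) * δ ^ d ≤ (δ⁻¹) ^ d * δ ^ d := by gcongr
      _ = 1 := by rw [← mul_pow, inv_mul_cancel₀ hδ0.ne', one_pow]
  rw [mul_assoc, hscale]
  refine le_of_mul_le_mul_left ?_ (show (0 : ℝ) < 2 * m by positivity)
  nlinarith

end
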